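/- Under assumptions (A1)-(A3), every strictly positive harmonic function f of the induced Markov chain X_M grows at most subexponentially: limsup_{|u|→∞} (1/|u|) log f(u) ≤ 0. -/

import Mathlib

open Filter Topology

attribute [local instance] Classical.propDecidable

noncomputable section

variable {V : Type*} [AddCommGroup V]

/-- `n`-step transition kernel of the random walk with step distribution `μ`,
killed upon leaving the set `A` : `kern μ A n x y = P_x(S n = y, τ_A > n)`,
where `τ_A` is the first exit time from `A`. -/
def kern (μ : V → ℝ) (A : Set V) : ℕ → V → V → ℝ
  | 0 => fun x y => if x = y ∧ x ∈ A then 1 else 0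
  | n + 1 => fun x y => ∑' z : V, (if x ∈ A then μ (z - x) else 0) * kern μ A n z y

/-- Green function of the walk killed outside `A`. -/
def green (μ : V → ℝ) (A : Set V) (x y : V) : ℝ :=
  ∑' n : ℕ, kern μ A n x y

/-- `E_x [ g(S τ) ; S τ ∈ B, τ < ∞ ]`, where `τ` is the first exit time from `A`. -/
def exitExp (μ : V → ℝ) (A B : Set V) (g : V → ℝ) (x : V) : ℝ :=
  ∑' n : ℕ, ∑' z : V, kern μ A n x z *
    ∑' y : V, (if y ∉ A ∧ y ∈ B then μ (y - z) else 0) * g y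

/-- `ℝ≥0∞`-valued version of `exitExp`. -/
def exitExpE (μ : V → ℝ) (A B : Set V) (g : V → ℝ) (x : V) : ENNReal :=
  ∑' n : ℕ, ∑' z : V, ENNReal.ofReal (kern μ A n x z) *
    ∑' y : V, ENNReal.ofReal ((if y ∉ A ∧ y ∈ B then μ (y - z) else 0) * g y)

/-- `P_x(S t = y for some t ≥ 0)` for the walk killed outside `A`
(first passage decomposition). -/
def hitProb (μ : V → ℝ) (A : Set V) (x y : V) : ℝ :=
  (if x = y ∧ x ∈ A then 1 else 0) +
    ∑' n : ℕ, ∑' z : V, kern μ (A \ {y}) n x z * (if y ∈ A then μ (y - z) else 0)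

/-- `h` is (strictly speaking, satisfies the mean value property of a) harmonic
function on `A` for the walk with step distribution `μ` killed outside `A`. -/
def HarmOn (μ : V → ℝ) (A : Set V) (h : V → ℝ) : Prop :=
  ∀ x ∈ A, h x = ∑' y : V, if y ∈ A then μ (y - x) * h y else 0

/-- Irreducibility of the walk killed outside `A`. -/
def Irred (μ : V → ℝ) (A : Set V) : Prop :=
  ∀ x ∈ A, ∀ x' ∈ A, ∃ (k : ℕ) (c : ℕ → V), c 0 = x ∧ c k = x' ∧
    (∀ j ≤ k, c j ∈ A) ∧ ∀ j < k, 0 < μ (c (j + 1) - c j)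

/-- A sequence `xs` is fundamental for the walk killed outside `A` :
the Martin kernels `G(x, xs n)/G(x₀, xs n)` converge for every `x ∈ A`. -/
def Fundamental (μ : V → ℝ) (A : Set V) (x₀ : V) (xs : ℕ → V) : Prop :=
  ∀ x ∈ A, ∃ L : ℝ,
    Tendsto (fun n => green μ A x (xs n) / green μ A x₀ (xs n)) atTop (𝓝 L)

/-- ℓ¹-norm of an integer vector. -/
def znorm {ι : Type*} [Fintype ι] (x : ι → ℤ) : ℝ := ∑ i, |(x i : ℝ)|

/-- ℓ¹-norm of a real vector. -/
def rnorm {ι : Type*} [Fintype ι] (q : ι → ℝ) : ℝ := ∑ i, |q i|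

variable {d : ℕ}

/-- `ℤ^{Λ,d}_+ = {x ∈ ℤ^d : xⁱ > 0 for all i ∈ Λ}`. -/
def posDom (Λ : Set (Fin d)) : Set (Fin d → ℤ) := {x | ∀ i ∈ Λ, 0 < x i}

/-- `ℤ^d_+ = {x ∈ ℤ^d : xⁱ > 0 for all i}`. -/
def posAll : Set (Fin d → ℤ) := {x | ∀ i, 0 < x i}

/-- `a · z` for `a ∈ ℝ^d`, `z ∈ ℤ^d`. -/
def dotZ (a : Fin d → ℝ) (z : Fin d → ℤ) : ℝ := ∑ i, a i * (z i : ℝ)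

/-- `a · q` for `a, q ∈ ℝ^d`. -/
def dotR (a q : Fin d → ℝ) : ℝ := ∑ i, a i * q i

/-- jump generating function `φ(a) = Σ_z μ(z) exp(a·z)` (valued in `ℝ≥0∞`). -/
def phiE (μ : (Fin d → ℤ) → ℝ) (a : Fin d → ℝ) : ENNReal :=
  ∑' z : Fin d → ℤ, ENNReal.ofReal (μ z * Real.exp (dotZ a z))

/-- `D = {a ∈ ℝ^d : φ(a) ≤ 1}`. -/
def Dset (μ : (Fin d → ℤ) → ℝ) : Set (Fin d → ℝ) := {a | phiE μ a ≤ 1}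

/-- mean vector `M = Σ_z μ(z) z`. -/
def Mvec (μ : (Fin d → ℤ) → ℝ) : Fin d → ℝ := fun i => ∑' z : Fin d → ℤ, μ z * (z i : ℝ)

/-- `Λ(M) = {i : Mⁱ = 0}`. -/
def LambdaM (μ : (Fin d → ℤ) → ℝ) : Set (Fin d) := {i | Mvec μ i = 0}

/-- Assumption (A1) : irreducibility on every `ℤ^{Λ,d}_+`. -/
def A1 (μ : (Fin d → ℤ) → ℝ) : Prop := ∀ Λ : Set (Fin d), Irred μ (posDom Λ)

/-- Assumption (A2) : `φ` is finite on a neighborhood of the set `D`. -/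
def A2 (μ : (Fin d → ℤ) → ℝ) : Prop :=
  ∃ U : Set (Fin d → ℝ), IsOpen U ∧ Dset μ ⊆ U ∧ ∀ a ∈ U, phiE μ a ≠ ⊤

/-- Assumption (A3) : `M ≠ 0`. -/
def A3 (μ : (Fin d → ℤ) → ℝ) : Prop := Mvec μ ≠ 0

/-- projection `x ↦ x^Λ`. -/
def projL (Λ : Set (Fin d)) (x : Fin d → ℤ) : ↥Λ → ℤ := fun i => x (i : Fin d)

/-- jump distribution `μ_Λ(v) = Σ_{x : x^Λ = v} μ(x)` of the projected walk. -/
def muL (μ : (Fin d → ℤ) → ℝ) (Λ : Set (Fin d)) (v : ↥Λ → ℤ) : ℝ :=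
  ∑' x : Fin d → ℤ, if projL Λ x = v then μ x else 0

/-- `ℤ^Λ_+`. -/
def posL (Λ : Set (Fin d)) : Set (↥Λ → ℤ) := {u | ∀ i, 0 < u i}

end

noncomputable section LatticeAverages

variable {ι : Type*} [Fintype ι]

/-- The standard basis vectors generate the lattice `ι → ℤ`. -/
lemma addSubgroup_eq_top_of_single_mem (H : AddSubgroup (ι → ℤ))
    (h : ∀ i, Pi.single i 1 ∈ H) : H = ⊤ := by
  refine eq_top_iff.2 fun z _ => ?_
  have hz : z = ∑ i, z i • (Pi.single i 1 : ι → ℤ) := by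
    funext j
    simp [Finset.sum_apply, Pi.single_apply]
  rw [hz]
  exact sum_mem fun i _ => H.zsmul_mem (h i) _

/-- The cube `[-N, N]^ι` in the integer lattice. -/
def cube (ι : Type*) [Fintype ι] (N : ℕ) : Finset (ι → ℤ) :=
  Fintype.piFinset fun _ => Finset.Icc (-(N : ℤ)) N

lemma mem_cube {N : ℕ} {x : ι → ℤ} : x ∈ cube ι N ↔ ∀ i, -(N : ℤ) ≤ x i ∧ x i ≤ N := by
  simp [cube]

lemma card_cube (N : ℕ) : (cube ι N).card = (2 * N + 1) ^ Fintype.card ι := by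
  have h : ((N : ℤ) + 1 + N).toNat = 2 * N + 1 := by omega
  simp [cube, h]

lemma card_cube_pos (N : ℕ) : (0 : ℝ) < (cube ι N).card := by
  rw [card_cube]
  positivity

lemma cube_subset_cube {M N : ℕ} (h : M ≤ N) : cube ι M ⊆ cube ι N := by
  intro x hx
  rw [mem_cube] at hx ⊢
  intro i
  have := hx i
  omega

/-- Cubes form a Følner sequence : enlarging a cube by a fixed width is asymptotically
negligible. -/
lemma tendsto_card_cube_ratio (k : ℕ) :
    Tendsto (fun N : ℕ => ((cube ι (N + k)).card : ℝ) / (cube ι N).card) atTop (𝓝 1) := by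
  have h1 : Tendsto (fun N : ℕ => 1 + (2 * k : ℝ) / (2 * N + 1)) atTop (𝓝 (1 + 0)) := by
    refine tendsto_const_nhds.add (Tendsto.div_atTop tendsto_const_nhds ?_)
    exact tendsto_atTop_add_const_right _ _
      (tendsto_natCast_atTop_atTop.const_mul_atTop (by norm_num))
  have h2 := h1.pow (Fintype.card ι)
  rw [add_zero, one_pow] at h2
  refine h2.congr fun N => ?_
  rw [card_cube, card_cube]
  push_cast
  rw [← div_pow]
  congr 1
  field_simp
  ring

/-- Translating a bounded function changes its sum over a cube only by a boundary term. -/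
lemma abs_sum_cube_translate_sub_le (h : (ι → ℤ) → ℝ) {K : ℝ} (hK : ∀ x, |h x| ≤ K)
    (w : ι → ℤ) {k : ℕ} (hk : ∀ i, |w i| ≤ k) (N : ℕ) :
    |∑ x ∈ cube ι N, (h (x + w) - h x)| ≤
      2 * K * (((cube ι (N + k)).card : ℝ) - (cube ι N).card) := by
  set B := cube ι N
  set E := cube ι (N + k)
  set B' := B.map (addRightEmbedding w)
  have hBE : B ⊆ E := cube_subset_cube (Nat.le_add_right N k)
  have hBE' : B' ⊆ E := by
    intro x hx
    obtain ⟨y, hy, rfl⟩ := Finset.mem_map.1 hx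
    have hy' := mem_cube.1 hy
    refine mem_cube.2 fun i => ?_
    have h1 := hy' i
    have h2 := abs_le.1 (hk i)
    simp only [addRightEmbedding_apply, Pi.add_apply]
    push_cast
    omega
  have hsum : ∑ x ∈ B, h (x + w) = ∑ x ∈ B', h x := by simp [B']
  have hcard : B'.card = B.card := Finset.card_map _
  have key : ∀ C ⊆ E, C.card = B.card → |∑ x ∈ E \ C, h x| ≤ K * ((E.card : ℝ) - B.card) := by
    intro C hC hc
    calc |∑ x ∈ E \ C, h x| ≤ ∑ x ∈ E \ C, |h x| := Finset.abs_sum_le_sum_abs _ _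
      _ ≤ ∑ _x ∈ E \ C, K := Finset.sum_le_sum fun x _ => hK x
      _ = K * ((E.card : ℝ) - B.card) := by
        rw [Finset.sum_const, nsmul_eq_mul, Finset.card_sdiff_of_subset hC,
          Nat.cast_sub (Finset.card_le_card hC), hc, mul_comm]
  have e1 := Finset.sum_sdiff (f := h) hBE
  have e2 := Finset.sum_sdiff (f := h) hBE'
  have k1 := abs_le.1 (key B hBE rfl)
  have k2 := abs_le.1 (key B' hBE' hcard)
  rw [Finset.sum_sub_distrib, hsum, abs_le]
  constructor <;> linarith [k1.1, k1.2, k2.1, k2.2]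

/-- Mean increment of `g` in the direction `z` over the cube of radius `N` centred at `b`. -/
def meanIncr (g : (ι → ℤ) → ℝ) (b : ι → ℤ) (N : ℕ) (z : ι → ℤ) : ℝ :=
  (∑ x ∈ cube ι N, (g (b + x + z) - g (b + x))) / (cube ι N).card

lemma abs_meanIncr_le (g : (ι → ℤ) → ℝ) (b z : ι → ℤ) (N : ℕ) {K : ℝ}
    (hK : ∀ x, |g (x + z) - g x| ≤ K) : |meanIncr g b N z| ≤ K := by
  rw [meanIncr, abs_div, abs_of_pos (card_cube_pos N), div_le_iff₀ (card_cube_pos N)]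
  calc _ ≤ ∑ x ∈ cube ι N, |g (b + x + z) - g (b + x)| := Finset.abs_sum_le_sum_abs _ _
    _ ≤ ∑ _x ∈ cube ι N, K := Finset.sum_le_sum fun x _ => hK _
    _ = K * (cube ι N).card := by rw [Finset.sum_const, nsmul_eq_mul, mul_comm]

/-- Mean increments are asymptotically additive in the direction. -/
lemma tendsto_meanIncr_add_sub (g : (ι → ℤ) → ℝ) (b : ℕ → ι → ℤ) (z w : ι → ℤ) {K : ℝ}
    (hK : ∀ x, |g (x + z) - g x| ≤ K) :
    Tendsto (fun N => meanIncr g (b N) N (z + w) - (meanIncr g (b N) N z + meanIncr g (b N) N w))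
      atTop (𝓝 0) := by
  obtain ⟨k, hk⟩ : ∃ k : ℕ, ∀ i, |w i| ≤ k := by
    refine ⟨∑ i, (w i).natAbs, fun i => ?_⟩
    have := Finset.single_le_sum (f := fun i => (w i).natAbs) (fun _ _ => Nat.zero_le _)
      (Finset.mem_univ i)
    rw [Int.abs_eq_natAbs]
    exact_mod_cast this
  have hlim : Tendsto (fun N : ℕ => 2 * K * (((cube ι (N + k)).card : ℝ) / (cube ι N).card - 1))
      atTop (𝓝 0) := by
    have := ((tendsto_card_cube_ratio (ι := ι) k).sub_const 1).const_mul (2 * K)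
    simpa using this
  refine squeeze_zero_norm (fun N => ?_) hlim
  have hpos := card_cube_pos (ι := ι) N
  have hb := abs_sum_cube_translate_sub_le (fun x => g (b N + x + z) - g (b N + x))
    (fun x => hK (b N + x)) w hk N
  have heq : meanIncr g (b N) N (z + w) - (meanIncr g (b N) N z + meanIncr g (b N) N w) =
      (∑ x ∈ cube ι N, ((g (b N + (x + w) + z) - g (b N + (x + w))) -
        (g (b N + x + z) - g (b N + x)))) / (cube ι N).card := by
    rw [meanIncr, meanIncr, meanIncr, ← add_div, ← sub_div, ← Finset.sum_add_distrib,
      ← Finset.sum_sub_distrib]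
    congr 1
    refine Finset.sum_congr rfl fun x _ => ?_
    rw [show b N + (x + w) + z = b N + x + (z + w) by abel,
      show b N + (x + w) = b N + x + w by abel]
    ring
  rw [heq, Real.norm_eq_abs, abs_div, abs_of_pos hpos, div_le_iff₀ hpos]
  refine hb.trans (le_of_eq ?_)
  field_simp

/-- Along an ultrafilter, mean increments converge to an additive functional. -/
lemma exists_addMonoidHom_tendsto_meanIncr (g : (ι → ℤ) → ℝ) (b : ℕ → ι → ℤ)
    (hg : ∀ z, ∃ K, ∀ x, |g (x + z) - g x| ≤ K) (U : Ultrafilter ℕ) (hU : ↑U ≤ (atTop : Filter ℕ)) :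
    ∃ A : (ι → ℤ) →+ ℝ, ∀ z, Tendsto (fun N => meanIncr g (b N) N z) U (𝓝 (A z)) := by
  have hex : ∀ z, ∃ a, Tendsto (fun N => meanIncr g (b N) N z) U (𝓝 a) := by
    intro z
    obtain ⟨K, hK⟩ := hg z
    have hc : IsCompact (Set.Icc (-K) K) := isCompact_Icc
    obtain ⟨a, -, ha⟩ := hc.ultrafilter_le_nhds (U.map fun N => meanIncr g (b N) N z) (by
      rw [le_principal_iff, Ultrafilter.coe_map, mem_map]
      exact Filter.univ_mem' fun N => abs_le.1 (abs_meanIncr_le g (b N) z N hK))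
    exact ⟨a, ha⟩
  choose A hA using hex
  refine ⟨AddMonoidHom.mk' A fun z w => ?_, hA⟩
  obtain ⟨K, hK⟩ := hg z
  have h1 := (tendsto_meanIncr_add_sub g b z w hK).mono_left hU
  have h2 := (hA (z + w)).sub ((hA z).add (hA w))
  linarith [tendsto_nhds_unique h1 h2]

/-- Jensen's inequality for mean increments. -/
lemma exp_meanIncr_le (g : (ι → ℤ) → ℝ) (b z : ι → ℤ) (N : ℕ) :
    Real.exp (meanIncr g b N z) ≤
      (∑ x ∈ cube ι N, Real.exp (g (b + x + z) - g (b + x))) / (cube ι N).card := by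
  have hpos := card_cube_pos (ι := ι) N
  have := convexOn_exp.map_sum_le (t := cube ι N) (w := fun _ => ((cube ι N).card : ℝ)⁻¹)
    (p := fun x => g (b + x + z) - g (b + x)) (fun _ _ => by positivity)
    (by rw [Finset.sum_const, nsmul_eq_mul, mul_inv_cancel₀ hpos.ne']) (fun _ _ => Set.mem_univ _)
  simpa [meanIncr, ← Finset.mul_sum, div_eq_inv_mul] using this

/-- An additive functional with exponential moment at most `1` under a centred probability
vanishes on the support. -/
lemma eq_zero_of_sum_mul_exp_le_one {ν : (ι → ℤ) → ℝ} (hν : ∀ z, 0 ≤ ν z) (h1 : HasSum ν 1)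
    (h0 : ∀ i, HasSum (fun z => ν z * (z i : ℝ)) 0) (A : (ι → ℤ) →+ ℝ)
    (hA : ∀ F : Finset (ι → ℤ), ∑ z ∈ F, ν z * Real.exp (A z) ≤ 1) {z : ι → ℤ} (hz : 0 < ν z) :
    A z = 0 := by
  have hexp : ∀ z, 0 ≤ ν z * Real.exp (A z) := fun z => mul_nonneg (hν z) (Real.exp_pos _).le
  have hs : Summable fun z => ν z * Real.exp (A z) := summable_of_sum_le hexp hA
  have hAz : ∀ z, A z = ∑ i, (z i : ℝ) * A (Pi.single i 1) := by
    intro z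
    have hz : z = ∑ i, z i • (Pi.single i 1 : ι → ℤ) := by
      funext j
      simp [Finset.sum_apply, Pi.single_apply]
    conv_lhs => rw [hz]
    rw [map_sum]
    exact Finset.sum_congr rfl fun i _ => by rw [map_zsmul, zsmul_eq_mul]
  have hA0 : HasSum (fun z => ν z * A z) 0 := by
    have := hasSum_sum (s := Finset.univ) (fun i _ => (h0 i).mul_right (A (Pi.single i 1)))
    simp only [zero_mul, Finset.sum_const_zero] at this
    refine this.congr_fun fun z => ?_
    rw [hAz z, Finset.mul_sum]
    exact Finset.sum_congr rfl fun i _ => by ring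
  have hall := (hs.hasSum.sub h1).sub hA0
  have hterm : ∀ z, 0 ≤ ν z * Real.exp (A z) - ν z - ν z * A z := by
    intro z
    nlinarith [hν z, Real.add_one_le_exp (A z)]
  have htot : (∑' z, ν z * Real.exp (A z)) ≤ 1 := hs.tsum_le_of_sum_le hA
  have hle := le_hasSum hall z fun y _ => hterm y
  by_contra hne
  nlinarith [Real.add_one_lt_exp hne]

end LatticeAverages

noncomputable section Superharmonic

variable {ι : Type*}

/-- The open positive orthant of the lattice `ι → ℤ`. -/
def orthant (ι : Type*) : Set (ι → ℤ) := {u | ∀ i, 0 < u i}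

lemma HarmOn.summable {V : Type*} [AddCommGroup V] {ν : V → ℝ} {S : Set V} {f : V → ℝ}
    (hf : ∀ x ∈ S, 0 < f x) (h : HarmOn ν S f) {x : V} (hx : x ∈ S) :
    Summable fun y => if y ∈ S then ν (y - x) * f y else 0 := by
  by_contra hns
  have := h x hx
  rw [tsum_eq_zero_of_not_summable hns] at this
  exact (hf x hx).ne' this

/-- A positive harmonic function dominates finite partial sums of its mean. -/
lemma HarmOn.sum_le {V : Type*} [AddCommGroup V] {ν : V → ℝ} (hν : ∀ z, 0 ≤ ν z) {S : Set V}
    {f : V → ℝ} (hf : ∀ x ∈ S, 0 < f x) (h : HarmOn ν S f) {x : V} (hx : x ∈ S) (F : Finset V)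
    (hF : ∀ z ∈ F, x + z ∈ S) : ∑ z ∈ F, ν z * f (x + z) ≤ f x := by
  have hs := h.summable hf hx
  have hle := hs.sum_le_tsum (F.map (addLeftEmbedding x)) fun y _ => by
    split_ifs with hy
    · exact mul_nonneg (hν _) (hf y hy).le
    · exact le_rfl
  rw [← h x hx, Finset.sum_map] at hle
  refine le_trans (le_of_eq (Finset.sum_congr rfl fun z hz => ?_)) hle
  simp [hF z hz]

/-- Harnack inequality along the translates of a path. -/
lemma HarmOn.exists_mul_le_of_path {ν : (ι → ℤ) → ℝ} (hν : ∀ z, 0 ≤ ν z) {f : (ι → ℤ) → ℝ}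
    (hf : ∀ x ∈ orthant ι, 0 < f x) (h : HarmOn ν (orthant ι) f) (c : ℕ → ι → ℤ) (k : ℕ)
    (hc : ∀ j ≤ k, c j ∈ orthant ι) (hstep : ∀ j < k, 0 < ν (c (j + 1) - c j)) :
    ∃ κ > 0, ∀ t : ι → ℤ, 0 ≤ t → κ * f (c k + t) ≤ f (c 0 + t) := by
  induction k with
  | zero => exact ⟨1, one_pos, fun t _ => by simp⟩
  | succ k ih =>
    obtain ⟨κ, hκ, ih⟩ := ih (fun j hj => hc j (by omega)) (fun j hj => hstep j (by omega))
    refine ⟨κ * ν (c (k + 1) - c k), mul_pos hκ (hstep k (by omega)), fun t ht => ?_⟩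
    have hmem : ∀ j ≤ k + 1, c j + t ∈ orthant ι := fun j hj i =>
      add_pos_of_pos_of_nonneg (hc j hj i) (ht i)
    have h1 := h.sum_le hν hf (hmem k (by omega)) {c (k + 1) - c k} (by
      intro z hz
      rw [Finset.mem_singleton.1 hz, show c k + t + (c (k + 1) - c k) = c (k + 1) + t by abel]
      exact hmem _ le_rfl)
    rw [Finset.sum_singleton, show c k + t + (c (k + 1) - c k) = c (k + 1) + t by abel] at h1
    rw [mul_assoc]
    exact (mul_le_mul_of_nonneg_left h1 hκ.le).trans (ih t ht)

/-- `log f`, extended from the orthant to the whole lattice by projecting onto the orthant. -/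
def logExt (f : (ι → ℤ) → ℝ) (x : ι → ℤ) : ℝ := Real.log (f (x ⊔ 1))

lemma logExt_eq (f : (ι → ℤ) → ℝ) {x : ι → ℤ} (hx : x ∈ orthant ι) :
    logExt f x = Real.log (f x) := by
  rw [logExt, sup_eq_left.2]
  intro i
  exact hx i

lemma sup_one_mem_orthant (x : ι → ℤ) : x ⊔ 1 ∈ orthant ι := fun i => by simp

variable [Fintype ι]

/-- The logarithm of a positive harmonic function has bounded increments. -/
lemma HarmOn.exists_logExt_incr_le {ν : (ι → ℤ) → ℝ} (hν : ∀ z, 0 ≤ ν z) {f : (ι → ℤ) → ℝ}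
    (hf : ∀ x ∈ orthant ι, 0 < f x) (h : HarmOn ν (orthant ι) f) (hirr : Irred ν (orthant ι))
    (z : ι → ℤ) : ∃ K, ∀ x, |logExt f (x + z) - logExt f x| ≤ K := by
  let H : AddSubgroup (ι → ℤ) :=
    { carrier := {z | ∃ K, ∀ x, |logExt f (x + z) - logExt f x| ≤ K}
      zero_mem' := ⟨0, fun x => by simp⟩
      add_mem' := by
        rintro z w ⟨K, hK⟩ ⟨K', hK'⟩
        refine ⟨K + K', fun x => ?_⟩
        have h1 := hK (x + w)
        have h2 := hK' x
        rw [show x + (z + w) = x + w + z by abel]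
        exact (abs_sub_le _ (logExt f (x + w)) _).trans (add_le_add h1 h2)
      neg_mem' := by
        rintro z ⟨K, hK⟩
        refine ⟨K, fun x => ?_⟩
        have h1 := hK (x + -z)
        rwa [neg_add_cancel_right, abs_sub_comm] at h1 }
  suffices hH : ∀ i, Pi.single i 1 ∈ H by
    have : z ∈ H := addSubgroup_eq_top_of_single_mem H hH ▸ AddSubgroup.mem_top z
    exact this
  intro i
  have h1 : (1 : ι → ℤ) ∈ orthant ι := fun _ => one_pos
  have h2 : (1 + Pi.single i 1 : ι → ℤ) ∈ orthant ι := fun j => by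
    have : (0 : ι → ℤ) ≤ Pi.single i 1 := Pi.single_nonneg.2 zero_le_one
    exact add_pos_of_pos_of_nonneg one_pos (this j)
  have harnack : ∀ u ∈ orthant ι, ∀ v ∈ orthant ι, ∃ K, ∀ t : ι → ℤ, 0 ≤ t →
      Real.log (f (v + t)) - Real.log (f (u + t)) ≤ K := by
    intro u hu v hv
    obtain ⟨k, c, rfl, rfl, hc, hs⟩ := hirr u hu v hv
    obtain ⟨κ, hκ, hle⟩ := h.exists_mul_le_of_path hν hf c k hc hs
    refine ⟨-Real.log κ, fun t ht => ?_⟩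
    have hp := hf (c k + t) fun i => add_pos_of_pos_of_nonneg (hv i) (ht i)
    have := Real.log_le_log (mul_pos hκ hp) (hle t ht)
    rw [Real.log_mul hκ.ne' hp.ne'] at this
    linarith
  obtain ⟨K, hK⟩ := harnack _ h1 _ h2
  obtain ⟨K', hK'⟩ := harnack _ h2 _ h1
  refine ⟨max 0 (max K K'), fun x => ?_⟩
  by_cases hx : 1 ≤ x i
  · have ht : (0 : ι → ℤ) ≤ x ⊔ 1 - 1 := sub_nonneg.2 le_sup_right
    have e1 : (x + Pi.single i 1) ⊔ 1 = 1 + Pi.single i 1 + (x ⊔ 1 - 1) := by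
      funext j
      by_cases hj : j = i
      · subst hj
        simp only [Pi.sup_apply, Pi.add_apply, Pi.single_eq_same, Pi.one_apply, Pi.sub_apply]
        rw [sup_eq_left.2 hx, sup_eq_left.2 (by omega)]
        ring
      · simp [hj]
    have e2 : x ⊔ 1 = 1 + (x ⊔ 1 - 1) := by abel
    have k1 := hK _ ht
    have k2 := hK' _ ht
    rw [← e1, ← e2] at k1 k2
    rw [logExt, logExt, abs_le]
    have m1 := le_max_right 0 (max K K')
    have m2 := le_max_left K K'
    have m3 := le_max_right K K'
    constructor <;> linarith
  · have e1 : (x + Pi.single i 1) ⊔ 1 = x ⊔ 1 := by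
      funext j
      by_cases hj : j = i
      · subst hj
        simp only [Pi.sup_apply, Pi.add_apply, Pi.single_eq_same, Pi.one_apply]
        rw [sup_eq_right.2 (by omega), sup_eq_right.2 (by omega)]
      · simp [hj]
    rw [logExt, logExt, e1, sub_self, abs_zero]
    exact le_max_left _ _

/-- Averaged superharmonicity of a positive harmonic function, deep inside the orthant. -/
lemma HarmOn.sum_mul_exp_meanIncr_le {ν : (ι → ℤ) → ℝ} (hν : ∀ z, 0 ≤ ν z) {f : (ι → ℤ) → ℝ}
    (hf : ∀ x ∈ orthant ι, 0 < f x) (h : HarmOn ν (orthant ι) f) {N : ℕ} {b : ι → ℤ}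
    (hb : ∀ i, 2 * (N : ℤ) + 1 ≤ b i) {F : Finset (ι → ℤ)} (hF : F ⊆ cube ι N) :
    ∑ z ∈ F, ν z * Real.exp (meanIncr (logExt f) b N z) ≤ 1 := by
  have hpos := card_cube_pos (ι := ι) N
  have hpt : ∀ x ∈ cube ι N,
      ∑ z ∈ F, ν z * Real.exp (logExt f (b + x + z) - logExt f (b + x)) ≤ 1 := by
    intro x hx
    have hx' := mem_cube.1 hx
    have hy : b + x ∈ orthant ι := fun i => by
      have h1 := hb i
      have h2 := hx' i
      simp only [Pi.add_apply]
      omega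
    have hyz : ∀ z ∈ F, b + x + z ∈ orthant ι := fun z hz i => by
      have h1 := hb i
      have h2 := hx' i
      have h3 := mem_cube.1 (hF hz) i
      simp only [Pi.add_apply]
      omega
    have hle := h.sum_le hν hf hy F hyz
    have hfy := hf _ hy
    have heq : ∑ z ∈ F, ν z * Real.exp (logExt f (b + x + z) - logExt f (b + x)) =
        (∑ z ∈ F, ν z * f (b + x + z)) / f (b + x) := by
      rw [Finset.sum_div]
      refine Finset.sum_congr rfl fun z hz => ?_
      rw [logExt_eq f hy, logExt_eq f (hyz z hz), Real.exp_sub, Real.exp_log hfy,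
        Real.exp_log (hf _ (hyz z hz)), mul_div_assoc]
    rw [heq, div_le_one hfy]
    exact hle
  calc ∑ z ∈ F, ν z * Real.exp (meanIncr (logExt f) b N z)
      ≤ ∑ z ∈ F, ν z * ((∑ x ∈ cube ι N,
          Real.exp (logExt f (b + x + z) - logExt f (b + x))) / (cube ι N).card) :=
        Finset.sum_le_sum fun z _ => mul_le_mul_of_nonneg_left (exp_meanIncr_le _ _ _ _) (hν z)
    _ = (∑ x ∈ cube ι N, ∑ z ∈ F,
          ν z * Real.exp (logExt f (b + x + z) - logExt f (b + x))) / (cube ι N).card := by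
        rw [Finset.sum_comm, Finset.sum_div]
        refine Finset.sum_congr rfl fun z _ => ?_
        rw [← Finset.mul_sum, mul_div_assoc]
    _ ≤ 1 := by
        rw [div_le_one hpos]
        calc _ ≤ ∑ _x ∈ cube ι N, (1 : ℝ) := Finset.sum_le_sum hpt
          _ = (cube ι N).card := by simp

/-- For a centred irreducible walk, large-scale averages of the increments of `log f` are
small, uniformly deep inside the orthant. -/
lemma HarmOn.exists_meanIncr_le {ν : (ι → ℤ) → ℝ} (hν : ∀ z, 0 ≤ ν z) (h1 : HasSum ν 1)
    (h0 : ∀ i, HasSum (fun z => ν z * (z i : ℝ)) 0) {f : (ι → ℤ) → ℝ}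
    (hf : ∀ x ∈ orthant ι, 0 < f x) (h : HarmOn ν (orthant ι) f) (hirr : Irred ν (orthant ι))
    {ε : ℝ} (hε : 0 < ε) : ∃ N : ℕ, ∀ b : ι → ℤ, (∀ i, 2 * (N : ℤ) + 1 ≤ b i) → ∀ i,
      meanIncr (logExt f) b N (Pi.single i 1) ≤ ε := by
  by_contra! hcon
  choose b hb i hi using hcon
  have hU : ↑(hyperfilter ℕ) ≤ (atTop : Filter ℕ) := Nat.hyperfilter_le_atTop
  obtain ⟨A, hA⟩ := exists_addMonoidHom_tendsto_meanIncr (logExt f) b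
    (h.exists_logExt_incr_le hν hf hirr) (hyperfilter ℕ) hU
  have hsum : ∀ F : Finset (ι → ℤ), ∑ z ∈ F, ν z * Real.exp (A z) ≤ 1 := by
    intro F
    have hlim : Tendsto (fun N => ∑ z ∈ F, ν z * Real.exp (meanIncr (logExt f) (b N) N z))
        (hyperfilter ℕ) (𝓝 (∑ z ∈ F, ν z * Real.exp (A z))) :=
      tendsto_finsetSum _ fun z _ =>
        ((Real.continuous_exp.tendsto _).comp (hA z)).const_mul (ν z)
    have hev : ∀ᶠ N : ℕ in atTop, F ⊆ cube ι N := by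
      have : ∀ᶠ N : ℕ in atTop, ∀ z ∈ F, z ∈ cube ι N := by
        rw [Filter.eventually_all_finset]
        intro z _
        filter_upwards [eventually_ge_atTop (∑ i, (z i).natAbs)] with N hN
        refine mem_cube.2 fun i => ?_
        have := Finset.single_le_sum (f := fun i => (z i).natAbs) (fun _ _ => Nat.zero_le _)
          (Finset.mem_univ i)
        omega
      exact this
    exact le_of_tendsto hlim ((hev.filter_mono hU).mono fun N hN =>
      h.sum_mul_exp_meanIncr_le hν hf (hb N) hN)
  have hsupp : ∀ z, 0 < ν z → A z = 0 := fun z hz =>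
    eq_zero_of_sum_mul_exp_le_one hν h1 h0 A hsum hz
  have hAi : ∀ j, A (Pi.single j 1) = 0 := by
    intro j
    obtain ⟨k, c, hc0, hck, -, hs⟩ := hirr 1 (fun _ => one_pos) (1 + Pi.single j 1) fun l => by
      have : (0 : ι → ℤ) ≤ Pi.single j 1 := Pi.single_nonneg.2 zero_le_one
      exact add_pos_of_pos_of_nonneg one_pos (this l)
    have hind : ∀ m ≤ k, A (c m) = A (c 0) := by
      intro m
      induction m with
      | zero => simp
      | succ m ih =>
        intro hm
        have := hsupp _ (hs m (by omega))
        rw [map_sub, sub_eq_zero] at this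
        rw [this, ih (by omega)]
    have := hind k le_rfl
    rw [hck, hc0, map_add] at this
    linarith
  have hev : ∀ᶠ N in (hyperfilter ℕ : Filter ℕ), ∀ j,
      meanIncr (logExt f) (b N) N (Pi.single j 1) < ε := by
    rw [Filter.eventually_all]
    intro j
    exact (hA (Pi.single j 1)).eventually_lt_const (by rw [hAi j]; exact hε)
  obtain ⟨N, hN⟩ := hev.exists
  exact (hN (i N)).not_gt (hi N)

lemma znorm_of_mem_orthant {u : ι → ℤ} (hu : u ∈ orthant ι) : znorm u = ∑ i, (u i : ℝ) :=
  Finset.sum_congr rfl fun i _ => abs_of_pos (by exact_mod_cast hu i)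

/-- A function on the orthant with unit-step increments at most `ε` grows at most linearly
with slope `ε`. -/
lemma le_add_mul_znorm_of_step_le {G : (ι → ℤ) → ℝ} {ε : ℝ} (hε : 0 ≤ ε)
    (hG : ∀ u ∈ orthant ι, ∀ i, G (u + Pi.single i 1) ≤ G u + ε) (u : ι → ℤ)
    (hu : u ∈ orthant ι) : G u ≤ G 1 + ε * znorm u := by
  obtain ⟨n, hn⟩ : ∃ n : ℕ, ∑ i, u i ≤ n := ⟨(∑ i, u i).toNat, Int.self_le_toNat _⟩
  induction n generalizing u with
  | zero =>
    have h0 : u = 1 := by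
      funext i
      have h1 := Finset.single_le_sum (f := u) (fun j _ => (hu j).le) (Finset.mem_univ i)
      have h2 := hu i
      push_cast at hn
      omega
    subst h0
    have : 0 ≤ znorm (1 : ι → ℤ) := Finset.sum_nonneg fun _ _ => abs_nonneg _
    nlinarith
  | succ n ih =>
    by_cases h1 : u = 1
    · subst h1
      have : 0 ≤ znorm (1 : ι → ℤ) := Finset.sum_nonneg fun _ _ => abs_nonneg _
      nlinarith
    · obtain ⟨i, hi⟩ := Function.ne_iff.1 h1
      have hui := hu i
      rw [Pi.one_apply] at hi
      have hv : u - Pi.single i 1 ∈ orthant ι := by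
        intro j
        by_cases hj : j = i
        · subst hj
          simp only [Pi.sub_apply, Pi.single_eq_same]
          omega
        · simpa [hj] using hu j
      have hsum : ∑ j, (u - Pi.single i 1 : ι → ℤ) j = ∑ j, u j - 1 := by
        simp [Finset.sum_sub_distrib]
      have hih := ih _ hv (by rw [hsum]; push_cast at hn; omega)
      have hst := hG _ hv i
      have hz : znorm (u - Pi.single i 1) = znorm u - 1 := by
        rw [znorm_of_mem_orthant hv, znorm_of_mem_orthant hu]
        exact_mod_cast congrArg (Int.cast : ℤ → ℝ) hsum
      rw [sub_add_cancel] at hst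
      rw [hz] at hih
      linarith

/-- Positive harmonic functions of a centred irreducible random walk killed outside the positive
orthant grow subexponentially. -/
lemma HarmOn.exists_log_le {ν : (ι → ℤ) → ℝ} (hν : ∀ z, 0 ≤ ν z) (h1 : HasSum ν 1)
    (h0 : ∀ i, HasSum (fun z => ν z * (z i : ℝ)) 0) {f : (ι → ℤ) → ℝ}
    (hf : ∀ x ∈ orthant ι, 0 < f x) (h : HarmOn ν (orthant ι) f) (hirr : Irred ν (orthant ι))
    {ε : ℝ} (hε : 0 < ε) : ∃ c, ∀ u ∈ orthant ι, Real.log (f u) ≤ c + ε * znorm u := by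
  obtain ⟨N, hN⟩ := h.exists_meanIncr_le hν h1 h0 hf hirr hε
  choose K hK using h.exists_logExt_incr_le hν hf hirr
  have hpos := card_cube_pos (ι := ι) N
  let T : ι → ℤ := fun _ => 2 * (N : ℤ)
  let G : (ι → ℤ) → ℝ := fun u => (∑ x ∈ cube ι N, logExt f (u + T + x)) / (cube ι N).card
  have hG : ∀ u ∈ orthant ι, ∀ i, G (u + Pi.single i 1) ≤ G u + ε := by
    intro u hu i
    have := hN (u + T) (fun j => by
      have := hu j
      simp only [Pi.add_apply, T]
      omega) i
    rw [meanIncr, Finset.sum_sub_distrib, sub_div, sub_le_iff_le_add'] at this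
    convert this using 4 with x
    rw [show u + Pi.single i 1 + T + x = u + T + x + Pi.single i 1 by abel]
  let c : ℝ := (∑ x ∈ cube ι N, K (T + x)) / (cube ι N).card
  refine ⟨c + G 1, fun u hu => ?_⟩
  have hgrow := le_add_mul_znorm_of_step_le hε.le hG u hu
  have hcmp : logExt f u ≤ c + G u := by
    rw [← add_div, ← Finset.sum_add_distrib, le_div_iff₀ hpos]
    calc logExt f u * (cube ι N).card = ∑ _x ∈ cube ι N, logExt f u := by
          rw [Finset.sum_const, nsmul_eq_mul, mul_comm]
      _ ≤ _ := Finset.sum_le_sum fun x _ => by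
          have := (abs_le.1 (hK (T + x) u)).1
          rw [← add_assoc] at this
          linarith
  rw [logExt_eq f hu] at hcmp
  linarith

end Superharmonic

section Projection

/-- Summation along the fibres of a map. -/
lemma HasSum.tsum_fiber_ite {X Y : Type*} {F : X → ℝ} {s : ℝ} (h : HasSum F s) (π : X → Y) :
    HasSum (fun y => ∑' x, if π x = y then F x else 0) s := by
  have h' : HasSum (F ∘ Equiv.sigmaFiberEquiv π) s := (Equiv.hasSum_iff _).2 h
  have h2 := h'.sigma fun y => (h'.summable.sigma_factor y).hasSum
  convert h2 using 2 with y
  have h3 := tsum_subtype {x | π x = y} F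
  refine Eq.trans ?_ h3.symm
  exact tsum_congr fun x => by simp [Set.indicator_apply]

variable {d : ℕ} {μ : (Fin d → ℤ) → ℝ}

lemma muL_nonneg (hnn : ∀ z, 0 ≤ μ z) (Λ : Set (Fin d)) (v : ↥Λ → ℤ) : 0 ≤ muL μ Λ v :=
  tsum_nonneg fun x => by
    split_ifs
    · exact hnn x
    · exact le_rfl

lemma le_muL_projL (hnn : ∀ z, 0 ≤ μ z) (hs : Summable μ) (Λ : Set (Fin d)) (z : Fin d → ℤ) :
    μ z ≤ muL μ Λ (projL Λ z) := by
  have hs' : Summable fun x => if projL Λ x = projL Λ z then μ x else 0 :=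
    Summable.of_nonneg_of_le (fun x => by split_ifs <;> [exact hnn x; exact le_rfl])
      (fun x => by split_ifs <;> [exact le_rfl; exact hnn x]) hs
  have := hs'.le_tsum z fun x _ => by split_ifs <;> [exact hnn x; exact le_rfl]
  rwa [if_pos rfl] at this

lemma hasSum_muL (h : HasSum μ 1) (Λ : Set (Fin d)) : HasSum (muL μ Λ) 1 := by
  convert h.tsum_fiber_ite (projL Λ) using 2 with v
  rw [muL]
  exact tsum_congr fun x => by congr

lemma hasSum_muL_mul_coord (Λ : Set (Fin d)) {s : ℝ} (i : ↥Λ)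
    (h : HasSum (fun z => μ z * (z (i : Fin d) : ℝ)) s) :
    HasSum (fun v => muL μ Λ v * (v i : ℝ)) s := by
  convert h.tsum_fiber_ite (projL Λ) using 2 with v
  rw [muL, ← tsum_mul_right]
  refine tsum_congr fun x => ?_
  split_ifs with hx
  · rw [← hx, projL]
  · simp

/-- Irreducibility passes to the projected walk. -/
lemma irred_muL (hnn : ∀ z, 0 ≤ μ z) (hs : Summable μ) (Λ : Set (Fin d))
    (h : Irred μ (posDom Λ)) : Irred (muL μ Λ) (posL Λ) := by
  intro x hx x' hx'
  let lift : (↥Λ → ℤ) → Fin d → ℤ := fun u j => if hj : j ∈ Λ then u ⟨j, hj⟩ else 0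
  have hproj : ∀ u, projL Λ (lift u) = u := fun u => by
    funext i
    simp [projL, lift]
  have hmem : ∀ u ∈ posL Λ, lift u ∈ posDom Λ := fun u hu j hj => by
    simpa [lift, hj] using hu ⟨j, hj⟩
  obtain ⟨k, c, h0, hk, hc, hstep⟩ := h _ (hmem x hx) _ (hmem x' hx')
  refine ⟨k, fun j => projL Λ (c j), by simp only [h0, hproj], by simp only [hk, hproj],
    fun j hj i => hc j hj i i.2, fun j hj => ?_⟩
  exact (hstep j hj).trans_le (le_muL_projL hnn hs Λ (c (j + 1) - c j))

/-- Under (A2) the step distribution has finite first moments. -/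
lemma summable_mul_coord (hnn : ∀ z, 0 ≤ μ z) (hsum : HasSum μ 1) (hA2 : A2 μ) (i : Fin d) :
    Summable fun z => μ z * (z i : ℝ) := by
  obtain ⟨U, hU, hDU, hfin⟩ := hA2
  have h0 : (0 : Fin d → ℝ) ∈ U := by
    apply hDU
    change phiE μ 0 ≤ 1
    have : phiE μ 0 = ∑' z, ENNReal.ofReal (μ z) := by simp [phiE, dotZ]
    rw [this, ← ENNReal.ofReal_tsum_of_nonneg hnn hsum.summable, hsum.tsum_eq, ENNReal.ofReal_one]
  have hcont : Continuous fun t : ℝ => (Pi.single i t : Fin d → ℝ) :=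
    continuous_single (A := fun _ => ℝ) i
  have hnear : ∀ᶠ t : ℝ in 𝓝 0, (Pi.single i t : Fin d → ℝ) ∈ U :=
    hcont.continuousAt.eventually_mem (hU.mem_nhds (by simpa using h0))
  have hnear' : ∀ᶠ t : ℝ in 𝓝 0, (Pi.single i (-t) : Fin d → ℝ) ∈ U := by
    have : Tendsto (fun t : ℝ => -t) (𝓝 0) (𝓝 0) := by simpa using (continuous_neg.tendsto (0 : ℝ))
    exact this.eventually hnear
  obtain ⟨t, ht, hpos⟩ := (((hnear.and hnear').filter_mono nhdsWithin_le_nhds).and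
    (self_mem_nhdsWithin : Set.Ioi (0 : ℝ) ∈ 𝓝[>] 0)).exists
  have hsm : ∀ s : ℝ, (Pi.single i s : Fin d → ℝ) ∈ U →
      Summable fun z : Fin d → ℤ => μ z * Real.exp (s * z i) := by
    intro s hs
    have hd : ∀ z, dotZ (Pi.single i s) z = s * z i := fun z => by
      simp [dotZ, Pi.single_apply]
    have h1 := ENNReal.summable_toReal (hfin _ hs)
    refine h1.congr fun z => ?_
    rw [ENNReal.toReal_ofReal (mul_nonneg (hnn z) (Real.exp_pos _).le), hd]
  have hpos' : 0 < t := hpos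
  refine Summable.of_norm_bounded (((hsm t ht.1).add (hsm (-t) ht.2)).mul_left t⁻¹) fun z => ?_
  rw [Real.norm_eq_abs, abs_mul, abs_of_nonneg (hnn z), ← mul_add, mul_left_comm]
  refine mul_le_mul_of_nonneg_left ?_ (hnn z)
  rw [inv_mul_eq_div, le_div_iff₀ hpos']
  have e1 := Real.add_one_le_exp (t * z i)
  have e2 := Real.add_one_le_exp (-t * z i)
  have p1 := Real.exp_pos (t * z i)
  have p2 := Real.exp_pos (-t * z i)
  rcases abs_cases (z i : ℝ) with ⟨h, -⟩ | ⟨h, -⟩ <;> rw [h] <;> nlinarith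

/-- A real limsup is nonpositive as soon as every positive number is an eventual upper bound. -/
lemma limsup_nonpos_of_forall_pos {X : Type*} {l : Filter X} {g : X → ℝ}
    (h : ∀ ε > 0, ∀ᶠ x in l, g x ≤ ε) : limsup g l ≤ 0 := by
  rw [limsup_eq]
  by_cases hb : BddBelow {a | ∀ᶠ x in l, g x ≤ a}
  · exact le_of_forall_pos_le_add fun ε hε => by
      rw [zero_add]
      exact csInf_le hb (h ε hε)
  · rw [Real.sInf_of_not_bddBelow hb]

end Projection

theorem statement11 {d : ℕ} (μ : (Fin d → ℤ) → ℝ)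
    (hnn : ∀ z, 0 ≤ μ z) (hsum : HasSum μ 1)
    (hA1 : A1 μ) (hA2 : A2 μ) (hA3 : A3 μ)
    (f : (↥(LambdaM μ) → ℤ) → ℝ) (hf : ∀ u ∈ posL (LambdaM μ), 0 < f u)
    (hharm : HarmOn (muL μ (LambdaM μ)) (posL (LambdaM μ)) f) :
    Filter.limsup (fun u : ↥(LambdaM μ) → ℤ => (znorm u)⁻¹ * Real.log (f u))
      (Filter.comap znorm atTop ⊓ 𝓟 (posL (LambdaM μ))) ≤ 0 := by
  have hirr := irred_muL hnn hsum.summable (LambdaM μ) (hA1 _)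
  have h0 : ∀ i : ↥(LambdaM μ), HasSum (fun v => muL μ (LambdaM μ) v * (v i : ℝ)) 0 := by
    intro i
    have h := (summable_mul_coord hnn hsum hA2 i).hasSum
    have hi : (∑' z, μ z * (z (i : Fin d) : ℝ)) = 0 := i.2
    rw [hi] at h
    exact hasSum_muL_mul_coord _ i h
  have h1 := hasSum_muL hsum (LambdaM μ)
  refine limsup_nonpos_of_forall_pos fun ε hε => ?_
  obtain ⟨c, hc⟩ := HarmOn.exists_log_le (f := f) (muL_nonneg hnn (LambdaM μ)) h1 h0 hf hharm
    hirr (half_pos hε)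
  have hlarge : ∀ᶠ u : ↥(LambdaM μ) → ℤ in comap znorm atTop, max 1 (2 * c / ε) ≤ znorm u :=
    tendsto_comap.eventually (eventually_ge_atTop _)
  filter_upwards [hlarge.filter_mono inf_le_left, mem_inf_of_right (mem_principal_self _)]
    with u hu hmem
  have hz : 0 < znorm u := one_pos.trans_le ((le_max_left _ _).trans hu)
  have hcz := (le_max_right _ _).trans hu
  rw [div_le_iff₀ hε] at hcz
  rw [inv_mul_le_iff₀ hz]
  linarith [hc u hmem]
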